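/- For every n ≥ 1, the choice principle C_{#=(n+1)▷n} (choice for closed subsets of [0,1] of cardinality exactly n+1 that intersect at least n of the n+1 fixed disjoint intervals) has no continuous realizer. -/

import Mathlib

/-! Framework: represented spaces, realizers, (strong) topological Weihrauch reducibility. -/

/-- Baire space ℕ^ℕ (with the product topology). -/
abbrev Baire : Type := ℕ → ℕ

/-- A standard pairing ⟨p, q⟩ on Baire space (interleaving). -/
def pairB (p q : Baire) : Baire := fun n => if n % 2 = 0 then p (n / 2) else q (n / 2)

/-- A representation of `X`: the name relation of a partial map from Baire space to `X`
(`R p x` means that `p` is a name of `x`). -/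
structure RepSp (X : Type*) where
  R : Baire → X → Prop

/-- Restriction of a representation to names in `A` (used for restrictions `f_A`). -/
def RepSp.restrict {X : Type*} (δ : RepSp X) (A : Set Baire) : RepSp X :=
  ⟨fun p x => δ.R p x ∧ p ∈ A⟩

/-- `F` is a realizer of the multivalued function `f` (whose domain is
`{x | (f x).Nonempty}`) with respect to the given representations. -/
def Realizes {X Y : Type*} (δX : RepSp X) (δY : RepSp Y) (f : X → Set Y)
    (F : Baire → Baire) : Prop :=
  ∀ p x, δX.R p x → (f x).Nonempty → ∃ y ∈ f x, δY.R (F p) y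

/-- Topological Weihrauch reducibility `f ≤_W g`: there are continuous partial functions
`H` (pre-processor) and `K` (post-processor) on Baire space such that
`p ↦ K⟨p, G (H p)⟩` realizes `f` for every realizer `G` of `g`. -/
def WRed {X Y U V : Type*} (δX : RepSp X) (δY : RepSp Y) (δU : RepSp U) (δV : RepSp V)
    (f : X → Set Y) (g : U → Set V) : Prop :=
  ∃ (H K : Baire → Baire) (dH dK : Set Baire), ContinuousOn H dH ∧ ContinuousOn K dK ∧
    ∀ G : Baire → Baire, Realizes δU δV g G →
      ∀ p x, δX.R p x → (f x).Nonempty →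
        p ∈ dH ∧ pairB p (G (H p)) ∈ dK ∧
          ∃ y ∈ f x, δY.R (K (pairB p (G (H p)))) y

/-- Strong topological Weihrauch reducibility `f ≤_sW g`:
`K ∘ G ∘ H` realizes `f` for every realizer `G` of `g`. -/
def SWRed {X Y U V : Type*} (δX : RepSp X) (δY : RepSp Y) (δU : RepSp U) (δV : RepSp V)
    (f : X → Set Y) (g : U → Set V) : Prop :=
  ∃ (H K : Baire → Baire) (dH dK : Set Baire), ContinuousOn H dH ∧ ContinuousOn K dK ∧
    ∀ G : Baire → Baire, Realizes δU δV g G →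
      ∀ p x, δX.R p x → (f x).Nonempty →
        p ∈ dH ∧ G (H p) ∈ dK ∧ ∃ y ∈ f x, δY.R (K (G (H p))) y

/-! Negative representation of closed subsets of a separable metric space with a
fixed dense sequence, Cauchy representation of points, and choice principles. -/

/-- An enumeration of the nonnegative rationals (as reals): `n ↦ a/(b+1)` with `(a,b)` = unpair. -/
noncomputable def ratCode (n : ℕ) : ℝ := (n.unpair.1 : ℝ) / ((n.unpair.2 : ℝ) + 1)

/-- The rational open ball of `X` coded by `n` (center from the dense sequence `α`,
rational radius; radius `0` yields the empty ball, allowing padding). -/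
noncomputable def ballCode {X : Type*} [MetricSpace X] (α : ℕ → X) (n : ℕ) : Set X :=
  Metric.ball (α n.unpair.1) (ratCode n.unpair.2)

/-- The negative representation `ψ₋` of closed sets: a name `p` enumerates rational open
balls and denotes `X` minus their union. -/
noncomputable def psiMinus {X : Type*} [MetricSpace X] (α : ℕ → X) (p : Baire) : Set X :=
  {x | ∀ i, x ∉ ballCode α (p i)}

/-- The represented space `A(X)` of closed subsets of `X` (negative information). -/
noncomputable def closedRep {X : Type*} [MetricSpace X] (α : ℕ → X) : RepSp (Set X) :=
  ⟨fun p A => A = psiMinus α p⟩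

/-- The Cauchy representation of points of `X` (w.r.t. the dense sequence `α`). -/
noncomputable def pointRep {X : Type*} [MetricSpace X] (α : ℕ → X) : RepSp X :=
  ⟨fun p x => ∀ i, dist x (α (p i)) < (2:ℝ)⁻¹ ^ i⟩

/-- Closed choice restricted to a class `𝔄` of sets: the multivalued map `A ↦ A` with
domain the nonempty members of `𝔄`. -/
def choiceFn {X : Type*} (𝔄 : Set (Set X)) : Set X → Set X :=
  fun A => {x | A ∈ 𝔄 ∧ x ∈ A}

/-- The class of (finite) sets of cardinality exactly `n`. -/
def cardEqClass (X : Type*) (n : ℕ) : Set (Set X) := {A | A.Finite ∧ A.ncard = n}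

/-- The class of nonempty (finite) sets of cardinality at most `n`. -/
def cardLeClass (X : Type*) (n : ℕ) : Set (Set X) :=
  {A | A.Finite ∧ A.Nonempty ∧ A.ncard ≤ n}

/-- The unit cube `[0,1]^n` inside `ℝ^n`. -/
def unitCube (n : ℕ) : Set (Fin n → ℝ) := Set.univ.pi fun _ => Set.Icc (0:ℝ) 1

/-- The class of nonempty closed convex subsets of the unit cube `[0,1]^n`. -/
def convexClass (n : ℕ) : Set (Set (Fin n → ℝ)) :=
  {A | A.Nonempty ∧ IsClosed A ∧ Convex ℝ A ∧ A ⊆ unitCube n}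

/-! Discrete spaces, Cantor space, products, composition, fractals. -/

/-- Cantor space `{0,1}^ℕ`, with the standard (first-difference) metric, whose topology
is the product topology. -/
noncomputable instance : MetricSpace (ℕ → Bool) := PiNat.metricSpace

/-- Representation of closed subsets of the discrete space `Fin k`:
a name enumerates the complement (`0` codes "nothing", `m+1` codes `m`). -/
def finSetRep (k : ℕ) : RepSp (Set (Fin k)) :=
  ⟨fun p A => A = {m : Fin k | ∀ i, p i ≠ (m : ℕ) + 1}⟩

/-- Representation of points of the discrete space `Fin k`: `p` names `m` iff `p 0 = m`. -/
def finPointRep (k : ℕ) : RepSp (Fin k) := ⟨fun p m => p 0 = (m : ℕ)⟩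

/-- Representation of closed subsets of the discrete space `ℕ`:
a name enumerates the complement (`0` codes "nothing", `m+1` codes `m`). -/
def natSetRep : RepSp (Set ℕ) := ⟨fun p A => A = {m : ℕ | ∀ i, p i ≠ m + 1}⟩

/-- Representation of points of the discrete space `ℕ`: `p` names `m` iff `p 0 = m`. -/
def natPointRep : RepSp ℕ := ⟨fun p m => p 0 = m⟩

/-- The `i`-th component of a name of an `n`-tuple (interleaving `n` streams). -/
def projB (n : ℕ) (i : Fin n) (p : Baire) : Baire := fun k => p (k * n + i)

/-- Representation of `n`-tuples: a name codes `n` names, interleaved. -/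
def piRep {X : Type*} (n : ℕ) (δ : RepSp X) : RepSp (Fin n → X) :=
  ⟨fun p x => ∀ i, δ.R (projB n i p) (x i)⟩

/-- The `n`-fold parallel product `f^n` of a multivalued function. -/
def piFn {X Y : Type*} (n : ℕ) (f : X → Set Y) : (Fin n → X) → Set (Fin n → Y) :=
  fun x => {y | ∀ i, y i ∈ f (x i)}

/-- Composition `g ∘ h` of multivalued functions: defined on those `t ∈ dom h` with
`h t ⊆ dom g`, mapping `t` to `⋃ {g u | u ∈ h t}`. -/
def mcomp {T U V : Type*} (g : U → Set V) (h : T → Set U) : T → Set V :=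
  fun t => {v | (h t).Nonempty ∧ (∀ u ∈ h t, (g u).Nonempty) ∧ ∃ u ∈ h t, v ∈ g u}

/-- `f` is a fractal: there is a multivalued `g` on a represented space with nonempty
carrier such that for every clopen `A` of Baire space the restriction `g_A` of `g` to
inputs with names in `A` is Weihrauch equivalent to `f`, or to the nowhere defined
function `0` (i.e. `g_A` has empty domain). -/
def Fractal {X Y : Type*} (δX : RepSp X) (δY : RepSp Y) (f : X → Set Y) : Prop :=
  ∃ (Z W : Type) (δZ : RepSp Z) (δW : RepSp W) (g : Z → Set W), Nonempty Z ∧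
    ∀ A : Set Baire, IsClopen A →
      (WRed (δZ.restrict A) δW δX δY g f ∧ WRed δX δY (δZ.restrict A) δW f g)
      ∨ ¬ ∃ p z, δZ.R p z ∧ p ∈ A ∧ (g z).Nonempty

/-- `f` is a closed fractal: as `Fractal`, with the witnessing representation total. -/
def ClosedFractal {X Y : Type*} (δX : RepSp X) (δY : RepSp Y) (f : X → Set Y) : Prop :=
  ∃ (Z W : Type) (δZ : RepSp Z) (δW : RepSp W) (g : Z → Set W), Nonempty Z ∧
    (∀ p : Baire, ∃ z, δZ.R p z) ∧
    ∀ A : Set Baire, IsClopen A →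
      (WRed (δZ.restrict A) δW δX δY g f ∧ WRed δX δY (δZ.restrict A) δW f g)
      ∨ ¬ ∃ p z, δZ.R p z ∧ p ∈ A ∧ (g z).Nonempty

/-- `X_ε(𝔄)`: the closure (in Baire space) of the set of `ψ₋`-names of sets `A ∈ 𝔄` such
that for every `x ∈ X` some `B ∈ 𝔄` satisfies `B ⊆ A \ B(x, ε)`. -/
noncomputable def Xeps {X : Type*} [MetricSpace X] (α : ℕ → X) (𝔄 : Set (Set X))
    (ε : ℝ) : Set Baire :=
  closure {p | psiMinus α p ∈ 𝔄 ∧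
    ∀ x : X, ∃ B ∈ 𝔄, B ⊆ psiMinus α p \ Metric.ball x ε}

/-- The represented space `ℝ_>`: a name is a nonincreasing sequence of rationals
converging to `x` (approximation from above). -/
noncomputable def gtRep : RepSp ℝ :=
  ⟨fun p x => (∀ i, ((Denumerable.ofNat ℚ (p (i+1)) : ℚ) : ℝ) ≤ ((Denumerable.ofNat ℚ (p i) : ℚ) : ℝ)) ∧
    Filter.Tendsto (fun i => ((Denumerable.ofNat ℚ (p i) : ℚ) : ℝ)) Filter.atTop (nhds x)⟩

/-- The class of closed subsets A of [0,1] with |A| = n that intersect at least k of the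
n intervals [2i/(2n), (2i+1)/(2n)], i = 0,…,n−1 (domain of C_{#=n▷k}). -/
def boxClass (n k : ℕ) : Set (Set ↥(Set.Icc (0:ℝ) 1)) :=
  {A | A.Finite ∧ A.ncard = n ∧
    k ≤ {i : Fin n | ∃ x ∈ A,
      2 * (i : ℝ) / (2 * n) ≤ (x : ℝ) ∧ (x : ℝ) ≤ (2 * (i : ℝ) + 1) / (2 * n)}.ncard}

open Filter Topology

theorem ratCode_zero : ratCode 0 = 0 := by
  simp [ratCode]

theorem ballCode_zero {X : Type*} [MetricSpace X] (α : ℕ → X) : ballCode α 0 = ∅ := by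
  simp [ballCode, ratCode_zero]

open Classical in
/-- A `ψ₋`-name of the closed set `A` listing only balls whose closed versions avoid `A`. -/
noncomputable def separatedName {X : Type*} [MetricSpace X] (α : ℕ → X) (A : Set X) : Baire :=
  fun c => if Disjoint (Metric.closedBall (α c.unpair.1) (ratCode c.unpair.2)) A then c else 0

theorem psiMinus_separatedName {X : Type*} [MetricSpace X] {α : ℕ → X} (hα : DenseRange α)
    {A : Set X} (hA : IsClosed A) : psiMinus α (separatedName α A) = A := by
  ext x
  constructor
  · intro hx
    by_contra hxA
    obtain ⟨ε, hε, hball⟩ := Metric.isOpen_iff.1 hA.isOpen_compl x hxA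
    obtain ⟨b, hb⟩ := exists_nat_one_div_lt (half_pos hε)
    obtain ⟨k, hk⟩ := hα.exists_dist_lt x (Nat.one_div_pos_of_nat (α := ℝ) (n := b))
    have hr : ratCode (Nat.pair 1 b) = 1 / ((b : ℝ) + 1) := by simp [ratCode]
    have hdisj : Disjoint (Metric.closedBall (α k) (ratCode (Nat.pair 1 b))) A := by
      rw [Set.disjoint_left, hr]
      intro z hz
      apply hball
      rw [Metric.mem_ball]
      rw [Metric.mem_closedBall] at hz
      linarith [dist_triangle z (α k) x, dist_comm x (α k)]
    refine hx (Nat.pair k (Nat.pair 1 b)) ?_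
    have hname : separatedName α A (Nat.pair k (Nat.pair 1 b)) = Nat.pair k (Nat.pair 1 b) :=
      if_pos (by simpa only [Nat.unpair_pair] using hdisj)
    rw [hname, ballCode, Nat.unpair_pair, Metric.mem_ball, hr]
    exact hk
  · intro hx c
    unfold separatedName
    split_ifs with h
    · exact fun hc => Set.disjoint_left.1 h (Metric.ball_subset_closedBall hc) hx
    · simp [ballCode_zero]

theorem eventually_notMem_ballCode_separatedName {X : Type*} [MetricSpace X] (α : ℕ → X)
    {A : Set X} {x : X} (hx : x ∈ A) (c : ℕ) :
    ∀ᶠ w in 𝓝 x, w ∉ ballCode α (separatedName α A c) := by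
  unfold separatedName
  split_ifs with h
  · filter_upwards [Metric.isClosed_closedBall.isOpen_compl.mem_nhds
      (fun hc => Set.disjoint_left.1 h hc hx)] with w hw hc
    exact hw (Metric.ball_subset_closedBall hc)
  · simp [ballCode_zero]

/-- A closed set avoiding the first `m` balls of `p` has a name extending that prefix. -/
theorem exists_psiMinus_eq_of_prefix {X : Type*} [MetricSpace X] {α : ℕ → X}
    (hα : DenseRange α) {A : Set X} (hA : IsClosed A) (p : Baire) (m : ℕ)
    (h : ∀ x ∈ A, ∀ i < m, x ∉ ballCode α (p i)) :
    ∃ q : Baire, (∀ i < m, q i = p i) ∧ psiMinus α q = A := by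
  refine ⟨fun i => if i < m then p i else separatedName α A (i - m), fun i hi => if_pos hi, ?_⟩
  ext x
  constructor
  · intro hx
    rw [← psiMinus_separatedName hα hA]
    intro i
    simpa using hx (i + m)
  · intro hx i
    by_cases hi : i < m
    · simpa [hi] using h x hx i hi
    · rw [← psiMinus_separatedName hα hA] at hx
      simpa [hi] using hx (i - m)

/-- The left endpoint of the `i`-th of the `n` intervals used in `boxClass`. -/
noncomputable def boxLeft (n : ℕ) (i : Fin n) : ↥(Set.Icc (0:ℝ) 1) :=
  ⟨2 * (i : ℝ) / (2 * n), by positivity, by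
    have hi : (i : ℝ) < n := by exact_mod_cast i.2
    exact div_le_one_of_le₀ (by linarith) (by positivity)⟩

theorem boxLeft_mem_box (n : ℕ) (i : Fin n) :
    2 * (i : ℝ) / (2 * n) ≤ (boxLeft n i : ℝ) ∧
      (boxLeft n i : ℝ) ≤ (2 * (i : ℝ) + 1) / (2 * n) :=
  ⟨le_rfl, by simp only [boxLeft]; gcongr; linarith⟩

theorem boxLeft_injective (n : ℕ) : Function.Injective (boxLeft n) := by
  intro i j h
  have hn : (n : ℝ) ≠ 0 := by
    have := i.2
    exact_mod_cast (by omega : n ≠ 0)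
  have h' : 2 * (i : ℝ) / (2 * n) = 2 * (j : ℝ) / (2 * n) := congrArg Subtype.val h
  field_simp at h'
  exact Fin.ext (by exact_mod_cast h')

theorem ncard_range_boxLeft (n : ℕ) : (Set.range (boxLeft n)).ncard = n := by
  rw [← Set.image_univ, Set.ncard_image_of_injective _ (boxLeft_injective n), Set.ncard_univ,
    Nat.card_fin]

theorem range_boxLeft_mem_boxClass {n k : ℕ} (hk : k ≤ n) :
    Set.range (boxLeft n) ∈ boxClass n k := by
  refine ⟨Set.finite_range _, ncard_range_boxLeft n, ?_⟩
  have hc : (Set.univ : Set (Fin n)).ncard = n := by rw [Set.ncard_univ, Nat.card_fin]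
  exact (hk.trans hc.ge).trans (Set.ncard_le_ncard
    (fun i _ => ⟨boxLeft n i, ⟨i, rfl⟩, boxLeft_mem_box n i⟩) (Set.toFinite _))

/-- Trading one left endpoint for an arbitrary new point loses at most one interval. -/
theorem exchange_boxLeft_mem_boxClass (n : ℕ) (j : Fin (n + 1)) {w : ↥(Set.Icc (0:ℝ) 1)}
    (hw : w ∉ Set.range (boxLeft (n + 1))) :
    insert w (Set.range (boxLeft (n + 1)) \ {boxLeft (n + 1) j}) ∈ boxClass (n + 1) n := by
  refine ⟨((Set.finite_range _).sdiff).insert w, ?_, ?_⟩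
  · rw [Set.ncard_exchange hw ⟨j, rfl⟩, ncard_range_boxLeft]
  · have hc : ({j}ᶜ : Set (Fin (n + 1))).ncard = n := by
      rw [Set.ncard_compl, Nat.card_fin, Set.ncard_singleton, Nat.add_sub_cancel]
    refine hc.symm.le.trans (Set.ncard_le_ncard ?_ (Set.toFinite _))
    intro i hi
    exact ⟨boxLeft (n + 1) i, Or.inr ⟨⟨i, rfl⟩, fun h => hi (boxLeft_injective _ h)⟩,
      boxLeft_mem_box _ i⟩

/-- For every n ≥ 1, C_{#=(n+1)▷n} has no continuous realizer. -/
theorem stmt16 (n : ℕ) (hn : 1 ≤ n) (α : ℕ → ↥(Set.Icc (0:ℝ) 1)) (hα : DenseRange α) :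
    ¬ ∃ (F : Baire → Baire) (dF : Set Baire), ContinuousOn F dF ∧
      ∀ p : Baire, psiMinus α p ∈ boxClass (n + 1) n →
        p ∈ dF ∧ ∃ y ∈ psiMinus α p, (pointRep α).R (F p) y := by
  rintro ⟨F, dF, hF, hreal⟩
  set A := Set.range (boxLeft (n + 1))
  have hAfin : A.Finite := Set.finite_range _
  set p := separatedName α A
  have hpA : psiMinus α p = A := psiMinus_separatedName hα hAfin.isClosed
  obtain ⟨hpF, y, hyA, hy⟩ := hreal p (hpA ▸ range_boxLeft_mem_boxClass n.le_succ)
  rw [hpA] at hyA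
  obtain ⟨j, rfl⟩ := hyA
  have : Nontrivial (Fin (n + 1)) := Fin.nontrivial_iff_two_le.2 (by omega)
  obtain ⟨k, hkj⟩ := exists_ne j
  set y := boxLeft (n + 1) j
  set z := boxLeft (n + 1) k
  have hzA : z ∈ A := ⟨k, rfl⟩
  have hzy : z ≠ y := fun h => hkj (boxLeft_injective _ h)
  obtain ⟨δ, hδ, hδA⟩ := Metric.isOpen_iff.1 (hAfin.sdiff (t := {y})).isClosed.isOpen_compl y
    (fun h => h.2 rfl)
  have hnear : ∀ x ∈ A \ {y}, δ / 2 < dist x y := by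
    intro x hx
    by_contra! h
    exact hδA (Metric.mem_ball.2 (by linarith)) hx
  have hq : ∀ m : ℕ, ∃ q : Baire, (∀ i < m, q i = p i) ∧
      psiMinus α q ∈ boxClass (n + 1) n ∧ ∀ x ∈ psiMinus α q, δ / 2 < dist x y := by
    intro m
    have hev : ∀ᶠ w in 𝓝 z, (∀ i < m, w ∉ ballCode α (p i)) ∧ δ / 2 < dist w y ∧
        w ∉ A \ {z} := by
      refine Filter.Eventually.and ?_ (Filter.Eventually.and ?_ ?_)
      · exact (Set.finite_lt_nat m).eventually_all.2
          fun i _ => eventually_notMem_ballCode_separatedName α hzA i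
      · exact (continuous_id.dist continuous_const).continuousAt.eventually_const_lt
          (hnear z ⟨hzA, hzy⟩)
      · exact (hAfin.sdiff (t := {z})).isClosed.isOpen_compl.mem_nhds fun h => h.2 rfl
    obtain ⟨w, ⟨hwp, hwy, hwA⟩, hwz⟩ :=
      ((hev.filter_mono nhdsWithin_le_nhds).and
        (self_mem_nhdsWithin : {z}ᶜ ∈ 𝓝[≠] z)).exists
    have hwA' : w ∉ A := fun h => hwA ⟨h, hwz⟩
    obtain ⟨q, hqp, hqA⟩ := exists_psiMinus_eq_of_prefix hα
      ((hAfin.sdiff (t := {y})).insert w).isClosed p m (by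
        rintro x (rfl | hx)
        · exact hwp
        · intro i _
          rw [← hpA] at hx
          exact hx.1 i)
    refine ⟨q, hqp, hqA ▸ exchange_boxLeft_mem_boxClass n j hwA', ?_⟩
    rw [hqA]
    rintro x (rfl | hx)
    · exact hwy
    · exact hnear x hx
  choose q hqp hqbox hqdist using hq
  have hqlim : Tendsto q atTop (𝓝 p) := by
    refine tendsto_pi_nhds.2 fun i => tendsto_const_nhds.congr' ?_
    filter_upwards [eventually_gt_atTop i] with m hm
    exact (hqp m i hm).symm
  have hFlim : Tendsto (fun m => F (q m)) atTop (𝓝 (F p)) :=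
    (hF p hpF).tendsto.comp (tendsto_nhdsWithin_iff.2
      ⟨hqlim, Eventually.of_forall fun m => (hreal _ (hqbox m)).1⟩)
  obtain ⟨i, hi⟩ := exists_pow_lt_of_lt_one (by positivity : 0 < δ / 4)
    (by norm_num : (2:ℝ)⁻¹ < 1)
  have hFi := tendsto_pi_nhds.1 hFlim i
  rw [nhds_discrete, tendsto_pure] at hFi
  obtain ⟨m, hm⟩ := hFi.exists
  obtain ⟨-, x, hx, hxF⟩ := hreal _ (hqbox m)
  have h1 := hxF i
  have h2 := hy i
  rw [hm] at h1
  linarith [hqdist m x hx, dist_triangle_right x y (α (F p i))]
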